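/- For each γ ∈ (0,1), the function R ↦ I_{0,γ}(R) / R² is monotone non-increasing on (0, ∞). -/

import Mathlib

open MeasureTheory

/-- Modified Bessel function of the second kind:
`K_ν(x) = ∫₀^∞ exp(−x cosh s) cosh(ν s) ds` (so `K_{−ν} = K_ν`). -/
noncomputable def besselK (ν x : ℝ) : ℝ :=
  ∫ s in Set.Ioi (0 : ℝ), Real.exp (-x * Real.cosh s) * Real.cosh (ν * s)

/-- Modified Bessel function of the first kind:
`I_ν(x) = Σ_{j≥0} (x/2)^{2j+ν}/(j! Γ(ν+j+1))`. -/
noncomputable def besselI (ν x : ℝ) : ℝ :=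
  ∑' j : ℕ, (x / 2) ^ (2 * (j : ℝ) + ν) / ((j.factorial : ℝ) * Real.Gamma (ν + j + 1))

/-- Normalizing constant `C(3,γ) = 2^{2γ} Γ(3/2+γ)/(π^{3/2} |Γ(−γ)|)`. -/
noncomputable def C3 (γ : ℝ) : ℝ :=
  2 ^ (2 * γ) * Real.Gamma (3 / 2 + γ) / (Real.pi ^ ((3 : ℝ) / 2) * |Real.Gamma (-γ)|)

/-- The kernel
`K_γ(ρ) = C(3,γ) (sinh ρ)⁻¹ ρ^{−1/2−γ} · 2 K_{3/2+γ}(ρ) / (Γ(3/2+γ) 2^{3/2+γ})`. -/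
noncomputable def Kker (γ ρ : ℝ) : ℝ :=
  C3 γ * (Real.sinh ρ)⁻¹ * ρ ^ (-(1 / 2 : ℝ) - γ) * (2 * besselK (3 / 2 + γ) ρ) /
    (Real.Gamma (3 / 2 + γ) * 2 ^ ((3 : ℝ) / 2 + γ))

/-- Scale function `I_{0,γ}(R) = 4π ∫₀^R ρ² K_γ(ρ) sinh²ρ dρ`. -/
noncomputable def scaleI0 (γ R : ℝ) : ℝ :=
  4 * Real.pi * ∫ ρ in (0 : ℝ)..R, ρ ^ 2 * Kker γ ρ * (Real.sinh ρ) ^ 2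

/-- Scale function `I_{∞,γ}(R) = 4π R² ∫_R^∞ K_γ(ρ) sinh²ρ dρ`. -/
noncomputable def scaleIinf (γ R : ℝ) : ℝ :=
  4 * Real.pi * R ^ 2 * ∫ ρ in Set.Ioi R, Kker γ ρ * (Real.sinh ρ) ^ 2

lemma aux_exp_bound {x c : ℝ} (hx : 0 < x) {s : ℝ} (hs : 0 ≤ s) :
    Real.exp (-x * Real.cosh s) * Real.exp (c * s) ≤ Real.exp ((c + 1) ^ 2 / x) * Real.exp (-s) := by
  rw [← Real.exp_add, ← Real.exp_add]
  apply Real.exp_le_exp.2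
  have h1 : s ^ 2 / 4 ≤ Real.cosh s := by
    rw [Real.cosh_eq]
    have := Real.quadratic_le_exp_of_nonneg hs
    have := Real.exp_pos (-s)
    nlinarith
  have h2 : x * (s ^ 2 / 4) ≤ x * Real.cosh s := mul_le_mul_of_nonneg_left h1 hx.le
  have h3 : (c + 1) * s ≤ x * (s ^ 2 / 4) + (c + 1) ^ 2 / x := by
    have : x * (s ^ 2 / 4) + (c + 1) ^ 2 / x - (c + 1) * s = (x * s / 2 - (c + 1)) ^ 2 / x := by
      field_simp
      ring
    have h4 : 0 ≤ (x * s / 2 - (c + 1)) ^ 2 / x := by positivity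
    linarith
  linarith

lemma aux_integrable {x c : ℝ} (hx : 0 < x) {F : ℝ → ℝ} (hF : Continuous F)
    (hb : ∀ s, 0 ≤ s → |F s| ≤ Real.exp (c * s)) :
    IntegrableOn (fun s => Real.exp (-x * Real.cosh s) * F s) (Set.Ioi 0) := by
  refine Integrable.mono' ((integrableOn_exp_neg_Ioi 0).const_mul (Real.exp ((c + 1) ^ 2 / x))) ?_ ?_
  · have : Continuous (fun s => Real.exp (-x * Real.cosh s) * F s) := by fun_prop
    exact this.aestronglyMeasurable
  · filter_upwards [ae_restrict_mem measurableSet_Ioi] with s hs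
    have hs0 : (0 : ℝ) ≤ s := le_of_lt hs
    rw [Real.norm_eq_abs, abs_mul, abs_of_pos (Real.exp_pos _)]
    exact (mul_le_mul_of_nonneg_left (hb s hs0) (Real.exp_pos _).le).trans (aux_exp_bound hx hs0)

lemma aux_cosh_le (μ s : ℝ) (hs : 0 ≤ s) : |Real.cosh (μ * s)| ≤ Real.exp (|μ| * s) := by
  rw [abs_of_pos (Real.cosh_pos _), Real.cosh_eq]
  have h1 : Real.exp (μ * s) ≤ Real.exp (|μ| * s) :=
    Real.exp_le_exp.2 (mul_le_mul_of_nonneg_right (le_abs_self _) hs)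
  have h2 : Real.exp (-(μ * s)) ≤ Real.exp (|μ| * s) := by
    apply Real.exp_le_exp.2
    rw [← neg_mul]
    exact (mul_le_mul_of_nonneg_right (neg_le_abs _) hs)
  linarith

lemma aux_sinh_le (μ s : ℝ) (hs : 0 ≤ s) : |Real.sinh (μ * s)| ≤ Real.exp (|μ| * s) := by
  refine le_trans ?_ (aux_cosh_le μ s hs)
  rw [abs_of_pos (Real.cosh_pos (μ * s))]
  apply abs_le_of_sq_le_sq _ (Real.cosh_pos _).le
  have := Real.cosh_sq (μ * s)
  linarith

lemma int_cosh {x : ℝ} (hx : 0 < x) (μ : ℝ) :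
    IntegrableOn (fun s => Real.exp (-x * Real.cosh s) * Real.cosh (μ * s)) (Set.Ioi 0) :=
  aux_integrable (c := |μ|) hx (by fun_prop) (aux_cosh_le μ)

lemma int_cosh_cosh {x : ℝ} (hx : 0 < x) (μ : ℝ) :
    IntegrableOn (fun s => Real.exp (-x * Real.cosh s) * (Real.cosh s * Real.cosh (μ * s)))
      (Set.Ioi 0) := by
  refine aux_integrable (c := 1 + |μ|) hx (by fun_prop) fun s hs => ?_
  rw [abs_mul, add_mul, Real.exp_add]
  have := aux_cosh_le 1 s hs
  simp only [abs_one, one_mul] at this ⊢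
  exact mul_le_mul this (aux_cosh_le μ s hs) (abs_nonneg _) (Real.exp_pos _).le

lemma int_sinh_sinh {x : ℝ} (hx : 0 < x) (μ : ℝ) :
    IntegrableOn (fun s => Real.exp (-x * Real.cosh s) * (Real.sinh s * Real.sinh (μ * s)))
      (Set.Ioi 0) := by
  refine aux_integrable (c := 1 + |μ|) hx (by fun_prop) fun s hs => ?_
  rw [abs_mul, add_mul, Real.exp_add]
  have := aux_sinh_le 1 s hs
  simp only [abs_one, one_mul] at this ⊢
  exact mul_le_mul this (aux_sinh_le μ s hs) (abs_nonneg _) (Real.exp_pos _).le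

lemma ibp {x : ℝ} (hx : 0 < x) (μ : ℝ) :
    x * ∫ s in Set.Ioi (0 : ℝ), Real.exp (-x * Real.cosh s) * (Real.sinh s * Real.sinh (μ * s)) =
      μ * besselK μ x := by
  have h := integral_Ioi_of_hasDerivAt_of_tendsto' (a := (0 : ℝ)) (m := (0 : ℝ))
    (f := fun s => Real.exp (-x * Real.cosh s) * Real.sinh (μ * s))
    (f' := fun s => μ * (Real.exp (-x * Real.cosh s) * Real.cosh (μ * s)) -
      x * (Real.exp (-x * Real.cosh s) * (Real.sinh s * Real.sinh (μ * s))))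
    (by
      intro s _
      have h1 : HasDerivAt (fun s => Real.exp (-x * Real.cosh s))
          (Real.exp (-x * Real.cosh s) * (-x * Real.sinh s)) s :=
        ((Real.hasDerivAt_cosh s).const_mul (-x)).exp
      have h2 : HasDerivAt (fun s => Real.sinh (μ * s)) (Real.cosh (μ * s) * (μ * 1)) s :=
        ((hasDerivAt_id s).const_mul μ).sinh
      exact (h1.mul h2).congr_deriv (by ring))
    (((int_cosh hx μ).const_mul μ).sub ((int_sinh_sinh hx μ).const_mul x))
    (by
      have ht : Filter.Tendsto (fun s : ℝ => Real.exp ((|μ| + 1) ^ 2 / x) * Real.exp (-s))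
          Filter.atTop (nhds 0) := by
        simpa using Real.tendsto_exp_neg_atTop_nhds_zero.const_mul (Real.exp ((|μ| + 1) ^ 2 / x))
      refine squeeze_zero_norm' ?_ ht
      filter_upwards [Filter.eventually_ge_atTop 0] with s hs
      rw [Real.norm_eq_abs, abs_mul, abs_of_pos (Real.exp_pos _)]
      exact (mul_le_mul_of_nonneg_left (aux_sinh_le μ s hs) (Real.exp_pos _).le).trans
        (aux_exp_bound hx hs))
  rw [integral_sub ((int_cosh hx μ).const_mul μ) ((int_sinh_sinh hx μ).const_mul x),
    integral_const_mul, integral_const_mul] at h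
  simp only [mul_zero, Real.sinh_zero, sub_zero] at h
  unfold besselK
  linarith

noncomputable def besselD (ν x : ℝ) : ℝ :=
  ∫ s in Set.Ioi (0 : ℝ), Real.exp (-x * Real.cosh s) * (Real.cosh s * Real.cosh (ν * s))

lemma hasDerivAt_besselK {x : ℝ} (hx : 0 < x) (ν : ℝ) :
    HasDerivAt (besselK ν) (-besselD ν x) x := by
  have h := hasDerivAt_integral_of_dominated_loc_of_deriv_le (𝕜 := ℝ)
    (μ := volume.restrict (Set.Ioi (0 : ℝ))) (x₀ := x) (s := Set.Ioi (x / 2))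
    (F := fun x s => Real.exp (-x * Real.cosh s) * Real.cosh (ν * s))
    (F' := fun x s => -(Real.exp (-x * Real.cosh s) * (Real.cosh s * Real.cosh (ν * s))))
    (bound := fun s => Real.exp (-(x / 2) * Real.cosh s) * (Real.cosh s * Real.cosh (ν * s)))
    (Ioi_mem_nhds (by linarith))
    (Filter.Eventually.of_forall fun y => by
      have : Continuous (fun s => Real.exp (-y * Real.cosh s) * Real.cosh (ν * s)) := by fun_prop
      exact this.aestronglyMeasurable)
    (int_cosh hx ν)
    (by
      have : Continuous (fun s =>
        -(Real.exp (-x * Real.cosh s) * (Real.cosh s * Real.cosh (ν * s)))) := by fun_prop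
      exact this.aestronglyMeasurable)
    (Filter.Eventually.of_forall fun s y hy => by
      have h1 := Real.cosh_pos s
      have h2 := Real.cosh_pos (ν * s)
      rw [norm_neg, Real.norm_eq_abs, abs_of_nonneg (by positivity)]
      apply mul_le_mul_of_nonneg_right _ (by positivity)
      apply Real.exp_le_exp.2
      have : x / 2 < y := hy
      nlinarith)
    (int_cosh_cosh (by linarith) ν)
    (Filter.Eventually.of_forall fun s y _ => by
      have h1 : HasDerivAt (fun y : ℝ => Real.exp (-y * Real.cosh s))
          (Real.exp (-y * Real.cosh s) * (-1 * Real.cosh s)) y :=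
        (((hasDerivAt_id y).neg).mul_const (Real.cosh s)).exp
      exact (h1.mul_const (Real.cosh (ν * s))).congr_deriv (by ring))
  have h2 := h.2
  rw [integral_neg] at h2
  exact h2

lemma besselD_down {x : ℝ} (hx : 0 < x) (ν : ℝ) :
    x * besselD ν x = x * besselK (ν - 1) x + ν * besselK ν x := by
  rw [← ibp hx ν, ← mul_add]
  congr 1
  unfold besselD besselK
  rw [← integral_add (int_cosh hx (ν - 1)) (int_sinh_sinh hx ν)]
  congr 1
  ext s
  rw [show (ν - 1) * s = ν * s - s by ring, Real.cosh_sub]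
  ring

lemma besselD_up {x : ℝ} (hx : 0 < x) (ν : ℝ) :
    x * besselD (ν - 1) x = x * besselK ν x - (ν - 1) * besselK (ν - 1) x := by
  rw [← ibp hx (ν - 1), ← mul_sub]
  congr 1
  unfold besselD besselK
  rw [← integral_sub (int_cosh hx ν) (int_sinh_sinh hx (ν - 1))]
  congr 1
  ext s
  rw [show ν * s = (ν - 1) * s + s by ring, Real.cosh_add]
  ring

lemma besselK_nonneg (ν x : ℝ) : 0 ≤ besselK ν x := by
  unfold besselK
  refine integral_nonneg fun s => ?_
  have := Real.cosh_pos (ν * s)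
  positivity

lemma ratio_aux {ν : ℝ} (hν : 1 ≤ ν) {s t : ℝ} (ht : 0 ≤ t) (hst : t ≤ s) :
    Real.cosh ((ν - 1) * s) * Real.cosh (ν * t) ≤ Real.cosh (ν * s) * Real.cosh ((ν - 1) * t) := by
  have h1 : Real.cosh ((ν - 1) * s + ν * t) ≤ Real.cosh (ν * s + (ν - 1) * t) := by
    apply Real.cosh_le_cosh.2
    rw [abs_of_nonneg, abs_of_nonneg] <;> nlinarith
  have h2 : Real.cosh ((ν - 1) * s - ν * t) ≤ Real.cosh (ν * s - (ν - 1) * t) := by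
    apply Real.cosh_le_cosh.2
    apply sq_le_sq.1
    have : 0 ≤ (2 * ν - 1) * ((s - t) * (s + t)) := by
      apply mul_nonneg (by linarith) (mul_nonneg (by linarith) (by linarith))
    nlinarith
  rw [Real.cosh_add, Real.cosh_add] at h1
  rw [Real.cosh_sub, Real.cosh_sub] at h2
  linarith

lemma cheb_aux {ν : ℝ} (hν : 1 ≤ ν) {s t : ℝ} (hs : 0 ≤ s) (ht : 0 ≤ t) :
    (Real.cosh s - Real.cosh t) * (Real.cosh ((ν - 1) * s) * Real.cosh (ν * t) -
      Real.cosh (ν * s) * Real.cosh ((ν - 1) * t)) ≤ 0 := by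
  rcases le_total t s with h | h
  · have h1 := ratio_aux hν ht h
    have h2 : Real.cosh t ≤ Real.cosh s := Real.cosh_le_cosh.2 (by rwa [abs_of_nonneg ht, abs_of_nonneg hs])
    exact mul_nonpos_of_nonneg_of_nonpos (by linarith) (by linarith)
  · have h1 := ratio_aux hν hs h
    have h2 : Real.cosh s ≤ Real.cosh t := Real.cosh_le_cosh.2 (by rwa [abs_of_nonneg ht, abs_of_nonneg hs])
    exact mul_nonpos_of_nonpos_of_nonneg (by linarith) (by linarith)

lemma int_comb {μ : Measure ℝ} {f₁ f₂ f₃ f₄ : ℝ → ℝ} {a b c d : ℝ} (h₁ : Integrable f₁ μ)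
    (h₂ : Integrable f₂ μ) (h₃ : Integrable f₃ μ) (h₄ : Integrable f₄ μ) :
    ∫ s, (a * f₁ s - b * f₂ s - c * f₃ s + d * f₄ s) ∂μ
      = a * (∫ s, f₁ s ∂μ) - b * (∫ s, f₂ s ∂μ) - c * (∫ s, f₃ s ∂μ) + d * (∫ s, f₄ s ∂μ) := by
  have i₁ : Integrable (fun s => a * f₁ s) μ := h₁.const_mul a
  have i₂ : Integrable (fun s => b * f₂ s) μ := h₂.const_mul b
  have i₃ : Integrable (fun s => c * f₃ s) μ := h₃.const_mul c
  have i₄ : Integrable (fun s => d * f₄ s) μ := h₄.const_mul d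
  have i₁₂ : Integrable (fun s => a * f₁ s - b * f₂ s) μ := i₁.sub i₂
  have i₁₂₃ : Integrable (fun s => a * f₁ s - b * f₂ s - c * f₃ s) μ := i₁₂.sub i₃
  rw [integral_add i₁₂₃ i₄, integral_sub i₁₂ i₃, integral_sub i₁ i₂,
    integral_const_mul, integral_const_mul, integral_const_mul, integral_const_mul]

lemma cheb1 {ν x : ℝ} (hν : 1 ≤ ν) (hx : 0 < x) {t : ℝ} (ht : 0 ≤ t) :
    Real.cosh (ν * t) * besselD (ν - 1) x - Real.cosh ((ν - 1) * t) * besselD ν x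
      - Real.cosh t * Real.cosh (ν * t) * besselK (ν - 1) x
      + Real.cosh t * Real.cosh ((ν - 1) * t) * besselK ν x ≤ 0 := by
  unfold besselD besselK
  rw [← int_comb (int_cosh_cosh hx _) (int_cosh_cosh hx _) (int_cosh hx _) (int_cosh hx _)]
  refine setIntegral_nonpos measurableSet_Ioi fun s hs => ?_
  have h := mul_nonpos_of_nonneg_of_nonpos (Real.exp_pos (-x * Real.cosh s)).le
    (cheb_aux hν (le_of_lt hs : (0 : ℝ) ≤ s) ht)
  refine le_trans (le_of_eq ?_) h
  ring

lemma cheb2 {ν x : ℝ} (hν : 1 ≤ ν) (hx : 0 < x) :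
    besselK ν x * besselD (ν - 1) x ≤ besselK (ν - 1) x * besselD ν x := by
  have h : ∫ t in Set.Ioi (0 : ℝ),
      (besselD (ν - 1) x * (Real.exp (-x * Real.cosh t) * Real.cosh (ν * t))
      - besselD ν x * (Real.exp (-x * Real.cosh t) * Real.cosh ((ν - 1) * t))
      - besselK (ν - 1) x * (Real.exp (-x * Real.cosh t) * (Real.cosh t * Real.cosh (ν * t)))
      + besselK ν x * (Real.exp (-x * Real.cosh t) * (Real.cosh t * Real.cosh ((ν - 1) * t)))) ≤ 0 := by
    refine setIntegral_nonpos measurableSet_Ioi fun t ht => ?_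
    have h := mul_nonpos_of_nonneg_of_nonpos (Real.exp_pos (-x * Real.cosh t)).le
      (cheb1 hν hx (le_of_lt ht : (0 : ℝ) ≤ t))
    refine le_trans (le_of_eq ?_) h
    ring
  rw [int_comb (int_cosh hx _) (int_cosh hx _) (int_cosh_cosh hx _) (int_cosh_cosh hx _)] at h
  change besselD (ν - 1) x * besselK ν x - besselD ν x * besselK (ν - 1) x
    - besselK (ν - 1) x * besselD ν x + besselK ν x * besselD (ν - 1) x ≤ 0 at h
  linarith

/-- The Riccati inequality. -/
lemma riccati {ν x : ℝ} (hν : 1 ≤ ν) (hx : 0 < x) :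
    x * besselK ν x ^ 2 ≤ x * besselK (ν - 1) x ^ 2
      + (2 * ν - 1) * besselK (ν - 1) x * besselK ν x := by
  have h := mul_le_mul_of_nonneg_left (cheb2 hν hx) hx.le
  have h1 := besselD_down hx ν
  have h2 := besselD_up hx ν
  have e1 : x * (besselK ν x * besselD (ν - 1) x) = besselK ν x * (x * besselD (ν - 1) x) := by ring
  have e2 : x * (besselK (ν - 1) x * besselD ν x) = besselK (ν - 1) x * (x * besselD ν x) := by ring
  rw [e1, e2, h1, h2] at h
  nlinarith

lemma alg_aux {D N S C x a : ℝ} (hD : 0 ≤ D) (hN : 0 ≤ N) (hx : 0 < x) (ha : 1 ≤ a)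
    (hS : x ≤ S) (hC : 0 < C) (hCS : C ^ 2 = S ^ 2 + 1)
    (hr : x * D ^ 2 ≤ x * N ^ 2 + 2 * a * N * D) :
    x * C * D ≤ (2 * a - 1) * S * D + x * N * S := by
  by_contra! hlt
  have hS0 : 0 < S := lt_of_lt_of_le hx hS
  have hDp : 0 < D := by
    rcases hD.eq_or_lt with h | h
    · rw [← h] at hlt
      have : 0 ≤ x * N * S := by positivity
      simp at hlt
      linarith
    · exact h
  -- T = x C - (2a-1) S, and x N S < T D
  set T := x * C - (2 * a - 1) * S with hT
  have h1 : x * N * S < T * D := by rw [hT]; linarith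
  have hNS : 0 ≤ x * N * S := by positivity
  have hTp : 0 < T := by
    by_contra! h
    have := mul_nonpos_of_nonpos_of_nonneg h hD
    linarith
  have h2 : (x * N * S) * (x * N * S + 2 * a * S * D) < (T * D) * (T * D + 2 * a * S * D) := by
    have : 0 < 2 * a * S * D := by positivity
    apply mul_lt_mul'' h1 (by linarith) hNS (by linarith)
  have h3 : T * (T + 2 * a * S) ≤ x ^ 2 * S ^ 2 := by
    have e : T * (T + 2 * a * S) = x ^ 2 * C ^ 2 - (2 * a - 2) * (x * C * S) - (2 * a - 1) * S ^ 2 := by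
      rw [hT]; ring
    have p1 : 0 ≤ (2 * a - 2) * (x * C * S) := mul_nonneg (by linarith) (by positivity)
    have p2 : S ^ 2 ≤ (2 * a - 1) * S ^ 2 := by nlinarith [sq_nonneg S]
    have p3 : x ^ 2 ≤ S ^ 2 := by nlinarith
    rw [e, hCS]
    linarith
  have h4 : (T * D) * (T * D + 2 * a * S * D) ≤ x ^ 2 * S ^ 2 * D ^ 2 := by
    have := mul_le_mul_of_nonneg_right h3 (sq_nonneg D)
    linarith
  have h5 : x * S ^ 2 * (x * D ^ 2) ≤ x * S ^ 2 * (x * N ^ 2 + 2 * a * N * D) :=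
    mul_le_mul_of_nonneg_left hr (by positivity)
  linarith

noncomputable def gfun (γ x : ℝ) : ℝ :=
  x ^ (1 / 2 - γ : ℝ) * (besselK (3 / 2 + γ) x * Real.sinh x)

lemma gfun_nonneg {γ x : ℝ} (hx : 0 < x) : 0 ≤ gfun γ x := by
  unfold gfun
  have := besselK_nonneg (3 / 2 + γ) x
  have := Real.sinh_pos_iff.2 hx
  positivity

lemma gfun_antitone {γ : ℝ} (hγ : 0 < γ) : AntitoneOn (gfun γ) (Set.Ioi 0) := by
  have hd : ∀ x ∈ Set.Ioi (0 : ℝ), HasDerivAt (gfun γ)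
      ((1 / 2 - γ) * x ^ (1 / 2 - γ - 1 : ℝ) * (besselK (3 / 2 + γ) x * Real.sinh x) +
        x ^ (1 / 2 - γ : ℝ) * (-besselD (3 / 2 + γ) x * Real.sinh x
          + besselK (3 / 2 + γ) x * Real.cosh x)) x := by
    intro x hx
    have hx : 0 < x := hx
    exact (Real.hasDerivAt_rpow_const (Or.inl hx.ne')).mul
      ((hasDerivAt_besselK hx _).mul (Real.hasDerivAt_sinh x))
  refine antitoneOn_of_deriv_nonpos (convex_Ioi 0)
    (fun x hx => (hd x hx).continuousAt.continuousWithinAt)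
    (fun x hx => (hd x (interior_subset hx)).differentiableAt.differentiableWithinAt) ?_
  intro x hx
  have hx := interior_subset hx
  rw [(hd x hx).deriv]
  have hx : 0 < x := hx
  rw [Real.rpow_sub_one hx.ne']
  have hp : 0 < x ^ (1 / 2 - γ : ℝ) := Real.rpow_pos_of_pos hx _
  have hr := riccati (ν := 3 / 2 + γ) (by linarith) hx
  have hdn := besselD_down hx (3 / 2 + γ)
  have hm := alg_aux (a := 1 + γ) (besselK_nonneg (3 / 2 + γ) x) (besselK_nonneg (3 / 2 + γ - 1) x)
    hx (by linarith) (Real.self_le_sinh_iff.2 hx.le) (Real.cosh_pos x) (Real.cosh_sq x)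
    (by linarith)
  generalize x ^ (1 / 2 - γ : ℝ) = p at *
  have e : (1 / 2 - γ) * (p / x) * (besselK (3 / 2 + γ) x * Real.sinh x) +
      p * (-besselD (3 / 2 + γ) x * Real.sinh x + besselK (3 / 2 + γ) x * Real.cosh x)
      = p / x * ((1 / 2 - γ) * besselK (3 / 2 + γ) x * Real.sinh x
        - (x * besselD (3 / 2 + γ) x) * Real.sinh x + x * Real.cosh x * besselK (3 / 2 + γ) x) := by
    field_simp
    ring
  rw [e, hdn]
  apply mul_nonpos_of_nonneg_of_nonpos (by positivity)
  linarith

lemma scale_antitone {g : ℝ → ℝ} (hg : AntitoneOn g (Set.Ioi 0)) (h0 : ∀ x, 0 < x → 0 ≤ g x) :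
    AntitoneOn (fun R : ℝ => (∫ ρ in (0 : ℝ)..R, ρ * g ρ) / R ^ 2) (Set.Ioi 0) := by
  have hsub : ∀ R : ℝ, 0 < R → (∫ ρ in (0 : ℝ)..R, ρ * g ρ) / R ^ 2
      = ∫ t in (0 : ℝ)..1, t * g (R * t) := by
    intro R hR
    have h := intervalIntegral.integral_comp_mul_left (a := 0) (b := 1)
      (fun ρ => ρ * g ρ) hR.ne'
    simp only [mul_zero, mul_one, smul_eq_mul] at h
    have h' : ∫ t in (0 : ℝ)..1, R * t * g (R * t) = R * ∫ t in (0 : ℝ)..1, t * g (R * t) := by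
      rw [← intervalIntegral.integral_const_mul]
      congr 1
      ext t
      ring
    rw [h'] at h
    field_simp
    field_simp at h
    linarith
  have hnn : ∀ R : ℝ, 0 < R → 0 ≤ ∫ ρ in (0 : ℝ)..R, ρ * g ρ := by
    intro R hR
    rw [intervalIntegral.integral_of_le hR.le]
    refine setIntegral_nonneg measurableSet_Ioc fun t ht => mul_nonneg ht.1.le (h0 t ht.1)
  have hii : ∀ R : ℝ, 0 < R → IntervalIntegrable (fun ρ => ρ * g ρ) volume 0 R →
      IntervalIntegrable (fun t => t * g (R * t)) volume 0 1 := by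
    intro R hR h
    have h2 := (h.comp_mul_left (c := R)).const_mul R⁻¹
    simp only [zero_div, div_self hR.ne'] at h2
    convert h2 using 2 with t
    field_simp
  intro R₁ h1 R₂ h2 hle
  have h1 : 0 < R₁ := h1
  have h2 : 0 < R₂ := h2
  simp only
  by_cases i2 : IntervalIntegrable (fun ρ => ρ * g ρ) volume 0 R₂
  · have i1 : IntervalIntegrable (fun ρ => ρ * g ρ) volume 0 R₁ := by
      apply i2.mono_set
      rw [Set.uIcc_of_le h1.le, Set.uIcc_of_le h2.le]
      exact Set.Icc_subset_Icc_right hle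
    rw [hsub _ h1, hsub _ h2]
    refine intervalIntegral.integral_mono_on_of_le_Ioo zero_le_one (hii _ h2 i2) (hii _ h1 i1) ?_
    intro t ht
    have ht0 := ht.1
    exact mul_le_mul_of_nonneg_left (hg (Set.mem_Ioi.2 (mul_pos h1 ht0))
      (Set.mem_Ioi.2 (mul_pos h2 ht0)) (mul_le_mul_of_nonneg_right hle ht0.le)) ht0.le
  · rw [intervalIntegral.integral_undef i2, zero_div]
    exact div_nonneg (hnn _ h1) (by positivity)

/-- Corollary 5.3: `R ↦ I_{0,γ}(R)/R²` is non-increasing on `(0,∞)`. -/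
theorem scaleI0_div_sq_antitone (γ : ℝ) (hγ : γ ∈ Set.Ioo (0 : ℝ) 1) :
    AntitoneOn (fun R : ℝ => scaleI0 γ R / R ^ 2) (Set.Ioi 0) := by
  obtain ⟨hγ0, hγ1⟩ := hγ
  have hG : 0 < Real.Gamma (3 / 2 + γ) := Real.Gamma_pos_of_pos (by linarith)
  set A : ℝ := C3 γ * 2 / (Real.Gamma (3 / 2 + γ) * 2 ^ ((3 : ℝ) / 2 + γ)) with hA
  have hC : 0 ≤ C3 γ := by
    unfold C3
    have := Real.pi_pos
    positivity
  have hA0 : 0 ≤ A := by positivity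
  have key : ∀ R : ℝ, 0 < R → scaleI0 γ R / R ^ 2
      = 4 * Real.pi * A * ((∫ ρ in (0 : ℝ)..R, ρ * gfun γ ρ) / R ^ 2) := by
    intro R hR
    have : ∫ ρ in (0 : ℝ)..R, ρ ^ 2 * Kker γ ρ * (Real.sinh ρ) ^ 2
        = ∫ ρ in (0 : ℝ)..R, A * (ρ * gfun γ ρ) := by
      rw [intervalIntegral.integral_of_le hR.le, intervalIntegral.integral_of_le hR.le]
      refine setIntegral_congr_fun measurableSet_Ioc fun ρ hρ => ?_
      have hρ0 : 0 < ρ := hρ.1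
      have hs := Real.sinh_pos_iff.2 hρ0
      have e : ρ ^ (1 / 2 - γ : ℝ) = ρ * ρ ^ (-(1 / 2 : ℝ) - γ) := by
        rw [show (1 / 2 - γ : ℝ) = (-(1 / 2 : ℝ) - γ) + 1 by ring, Real.rpow_add_one hρ0.ne']
        ring
      simp only [Kker, gfun, hA, e]
      field_simp
    unfold scaleI0
    rw [this, intervalIntegral.integral_const_mul]
    ring
  intro R₁ h1 R₂ h2 hle
  have := scale_antitone (gfun_antitone hγ0) (fun x hx => gfun_nonneg hx) h1 h2 hle
  simp only at this ⊢
  rw [key _ h1, key _ h2]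
  exact mul_le_mul_of_nonneg_left this (by have := Real.pi_pos; positivity)
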